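/- Let q = 2^m with m a positive integer and let a ∈ F_q be nonzero. Then f(X) = X^{2q^2} + a X^{q^2+q-1} + a X^{q^2-q+1} is a permutation polynomial of F_{q^3}. -/

import Mathlib

/-- The relation `h = x + x (y + z) / n` with `n ^ 2 = x y z`, rewritten as a quadratic equation
for `x` with coefficients involving `k = (x y + y z + z x) / n`. -/
lemma quadratic_of_twisted_value {F : Type*} [Field F] [CharP F 2] {x y z n k h : F}
    (hn0 : n ≠ 0) (hn : n ^ 2 = x * y * z) (hk : k * n = x * y + y * z + z * x)
    (hh : h * n = x * (n + y + z)) : x ^ 2 + (h + k) * x + n = 0 := by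
  have h2 : (2 : F) = 0 := CharTwo.two_eq_zero
  apply mul_left_cancel₀ hn0
  grind

/-- The elementary symmetric functions of the three conjugate values. -/
lemma symmetric_of_twisted_values {F : Type*} [Field F] [CharP F 2] {x y z n k h₁ h₂ h₃ : F}
    (hn0 : n ≠ 0) (hn : n ^ 2 = x * y * z) (hk : k * n = x * y + y * z + z * x)
    (hh₁ : h₁ * n = x * (n + y + z)) (hh₂ : h₂ * n = y * (n + z + x))
    (hh₃ : h₃ * n = z * (n + x + y)) :
    h₁ + h₂ + h₃ = x + y + z ∧
    h₁ * h₂ + h₂ * h₃ + h₃ * h₁ =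
      k * (n + k + 1 + (x + y + z)) + (x + y + z) + (n + k) ∧
    h₁ * h₂ + h₂ * h₃ + h₃ * h₁ + h₁ * h₂ * h₃ =
      (x + y + z) + (x + y + z) ^ 2 + (n + k) ^ 2 := by
  have h2 : (2 : F) = 0 := CharTwo.two_eq_zero
  obtain rfl : h₁ = x * (n + y + z) / n := by rw [eq_div_iff hn0, hh₁]
  obtain rfl : h₂ = y * (n + z + x) / n := by rw [eq_div_iff hn0, hh₂]
  obtain rfl : h₃ = z * (n + x + y) / n := by rw [eq_div_iff hn0, hh₃]
  obtain rfl : k = (x * y + y * z + z * x) / n := by rw [eq_div_iff hn0, hk]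
  refine ⟨?_, ?_, ?_⟩
  · field_simp
    grind
  · field_simp
    grind
  · field_simp
    grind

/-- The map `x ↦ x + x (σ x + σ² x) / n`, where `n` is a square root of the norm of `x`, is
injective on nonzero elements. -/
lemma eq_of_twisted_value_eq {F : Type*} [Field F] [CharP F 2] (σ : F →+* F)
    (hσ : ∀ x, σ (σ (σ x)) = x) {x x' n n' h : F} (hx : x ≠ 0) (hx' : x' ≠ 0)
    (hn : n ^ 2 = x * σ x * σ (σ x)) (hn' : n' ^ 2 = x' * σ x' * σ (σ x'))
    (hh : h * n = x * (n + σ x + σ (σ x))) (hh' : h * n' = x' * (n' + σ x' + σ (σ x'))) :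
    x = x' := by
  have h2 : (2 : F) = 0 := CharTwo.two_eq_zero
  have norm_ne : ∀ {u : F}, u ≠ 0 → u * σ u * σ (σ u) ≠ 0 := fun hu =>
    mul_ne_zero (mul_ne_zero hu ((map_ne_zero σ).2 hu))
      ((map_ne_zero σ).2 ((map_ne_zero σ).2 hu))
  have root_ne : ∀ {u m : F}, u ≠ 0 → m ^ 2 = u * σ u * σ (σ u) → m ≠ 0 := by
    rintro u m hu hm rfl
    exact norm_ne hu (by rw [← hm]; ring)
  have hn0 := root_ne hx hn
  have hn0' := root_ne hx' hn'
  have fix : ∀ {u m : F}, m ^ 2 = u * σ u * σ (σ u) → σ m = m := by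
    intro u m hm
    apply CharTwo.sq_injective
    change σ m ^ 2 = m ^ 2
    rw [← map_pow, hm, map_mul, map_mul, hσ]
    ring
  have hσn := fix hn
  have hσn' := fix hn'
  have conj : ∀ {u m : F}, σ m = m → h * m = u * (m + σ u + σ (σ u)) →
      σ h * m = σ u * (m + σ (σ u) + u) ∧ σ (σ h) * m = σ (σ u) * (m + u + σ u) := by
    intro u m hm hu
    have h₁ := congrArg σ hu
    simp only [map_mul, map_add, hm, hσ] at h₁
    have h₂ := congrArg σ h₁
    simp only [map_mul, map_add, hm, hσ] at h₂
    exact ⟨h₁, h₂⟩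
  obtain ⟨k, hk⟩ : ∃ k, k * n = x * σ x + σ x * σ (σ x) + σ (σ x) * x :=
    ⟨_, div_mul_cancel₀ _ hn0⟩
  obtain ⟨k', hk'⟩ : ∃ k', k' * n' = x' * σ x' + σ x' * σ (σ x') + σ (σ x') * x' :=
    ⟨_, div_mul_cancel₀ _ hn0'⟩
  obtain ⟨s₁, s₂, s₃⟩ :=
    symmetric_of_twisted_values hn0 hn hk hh (conj hσn hh).1 (conj hσn hh).2
  obtain ⟨t₁, t₂, t₃⟩ :=
    symmetric_of_twisted_values hn0' hn' hk' hh' (conj hσn' hh').1 (conj hσn' hh').2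
  have e₁ : x + σ x + σ (σ x) = x' + σ x' + σ (σ x') := s₁.symm.trans t₁
  have hw : n + k = n' + k' := by
    apply CharTwo.sq_injective
    change (n + k) ^ 2 = (n' + k') ^ 2
    rw [s₃, e₁] at t₃
    exact add_left_cancel t₃
  have hkk : (k + k') * (n + k + 1 + (x + σ x + σ (σ x))) = 0 := by
    rw [s₂, ← e₁, ← hw] at t₂
    grind
  rcases mul_eq_zero.1 hkk with hk0 | hdeg
  · have hkeq : k' = k := (CharTwo.add_eq_zero.1 hk0).symm
    subst hkeq
    have hneq : n' = n := (add_right_cancel hw).symm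
    subst hneq
    have hroot : (x' + x) * ((x' + σ x) * (x' + σ (σ x))) = 0 := by grind
    have rat : σ h = h → x = σ x := by
      intro hfix
      have q₁ := quadratic_of_twisted_value hn0 hn hk hh
      have q₂ := congrArg σ q₁
      have hσk : σ k' = k' := by
        have := congrArg σ hk
        simp only [map_mul, map_add, hσn, hσ] at this
        apply mul_right_cancel₀ hn0
        rw [this, hk]
        ring
      simp only [map_mul, map_add, map_pow, map_zero, hσn, hσk, hfix] at q₂
      have q₃ := congrArg σ q₂
      simp only [map_mul, map_add, map_pow, map_zero, hσn, hσk, hfix] at q₃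
      by_contra hne
      have r₁ : σ x + x = h + k' := by
        have : (x + σ x) * (x + σ x + (h + k')) = 0 := by grind
        rcases mul_eq_zero.1 this with h0 | h0
        · exact absurd (CharTwo.add_eq_zero.1 h0) hne
        · grind
      have r₂ := congrArg σ r₁
      simp only [map_add, hσk, hfix] at r₂
      have : σ (σ x) = x := by grind
      apply hne
      calc x = σ (σ (σ x)) := (hσ x).symm
        _ = σ x := by rw [this]
    rcases mul_eq_zero.1 hroot with h0 | h0
    · exact (CharTwo.add_eq_zero.1 h0).symm
    · rcases mul_eq_zero.1 h0 with h0 | h0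
      · have hx1 : x' = σ x := CharTwo.add_eq_zero.1 h0
        have hfix : σ h = h := by
          apply mul_right_cancel₀ hn0
          rw [(conj hσn hh).1, hh', hx1, hσ]
        rw [hx1, ← rat hfix]
      · have hx1 : x' = σ (σ x) := CharTwo.add_eq_zero.1 h0
        have hfix : σ (σ h) = h := by
          apply mul_right_cancel₀ hn0
          rw [(conj hσn hh).2, hh', hx1, hσ]
        have hfix' : σ h = h := by
          have := congrArg σ hfix
          rw [hσ] at this
          exact this.symm
        rw [hx1, ← rat hfix', ← rat hfix']
  · have one : ∀ {u m l : F}, m ≠ 0 → σ m = m → m ^ 2 = u * σ u * σ (σ u) →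
        l * m = u * σ u + σ u * σ (σ u) + σ (σ u) * u →
        m + l + 1 + (u + σ u + σ (σ u)) = 0 → u = 1 := by
      intro u m l hm0 hm hm2 hl hd
      have hroot : (m + u) * ((m + σ u) * (m + σ (σ u))) = 0 := by grind
      have hum : u = m := by
        rcases mul_eq_zero.1 hroot with h0 | h0
        · exact (CharTwo.add_eq_zero.1 h0).symm
        · rcases mul_eq_zero.1 h0 with h0 | h0
          · rw [← hσ u, ← CharTwo.add_eq_zero.1 h0, hm, hm]
          · rw [← hσ u, ← CharTwo.add_eq_zero.1 h0, hm]
      subst hum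
      rw [hm, hm] at hm2
      exact mul_left_cancel₀ (pow_ne_zero 2 hm0) (by linear_combination -hm2)
    rw [one hn0 hσn hn hk hdeg, one hn0' hσn' hn' hk' (by rw [← hw, ← e₁, hdeg])]

/-- The map `x ↦ x + x (σ x + σ² x) / n` has no nonzero root. -/
lemma twisted_value_ne_zero {F : Type*} [Field F] [CharP F 2] (σ : F →+* F)
    (hσ : ∀ x, σ (σ (σ x)) = x) {x n : F} (hx : x ≠ 0)
    (hn : n ^ 2 = x * σ x * σ (σ x)) : n + σ x + σ (σ x) ≠ 0 := by
  intro h0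
  have h2 : (2 : F) = 0 := CharTwo.two_eq_zero
  have hσn : σ n = n := by
    apply CharTwo.sq_injective
    change σ n ^ 2 = n ^ 2
    rw [← map_pow, hn, map_mul, map_mul, hσ]
    ring
  have h₁ := congrArg σ h0
  simp only [map_add, map_zero, hσn, hσ] at h₁
  have h₂ := congrArg σ h₁
  simp only [map_add, map_zero, hσn, hσ] at h₂
  have hn0 : n = 0 := by grind
  rw [hn0] at hn
  have := mul_ne_zero (mul_ne_zero hx ((map_ne_zero σ).2 hx))
      ((map_ne_zero σ).2 ((map_ne_zero σ).2 hx))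
  exact this (by rw [← hn]; ring)

/-- The case of parameter `1`. -/
lemma injective_twisted_trinomial {F : Type*} [Field F] [Finite F] [CharP F 2] (σ : F →+* F)
    (hσ : ∀ x, σ (σ (σ x)) = x) :
    Function.Injective (fun x : F =>
      σ (σ x) ^ 2 + σ (σ x) * σ x * x⁻¹ + σ (σ x) * x * (σ x)⁻¹) := by
  have h2 : (2 : F) = 0 := CharTwo.two_eq_zero
  have root : ∀ x : F, x ≠ 0 → ∃ n h : F, n ^ 2 = σ (σ x) * σ (σ (σ x)) * σ (σ (σ (σ x))) ∧
      n ≠ 0 ∧ h * n = σ (σ x) * (n + σ (σ (σ x)) + σ (σ (σ (σ x)))) ∧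
      h ^ 2 = σ (σ x) ^ 2 + σ (σ x) * σ x * x⁻¹ + σ (σ x) * x * (σ x)⁻¹ := by
    intro x hx
    have hx₁ : σ x ≠ 0 := (map_ne_zero σ).2 hx
    have hx₂ : σ (σ x) ≠ 0 := (map_ne_zero σ).2 hx₁
    obtain ⟨n, hn⟩ := (Finite.injective_iff_surjective.1 (CharTwo.sq_injective (R := F)))
      (σ (σ x) * x * σ x)
    change n ^ 2 = _ at hn
    have hn0 : n ≠ 0 := by
      rintro rfl
      exact mul_ne_zero (mul_ne_zero hx₂ hx) hx₁ (by rw [← hn]; ring)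
    simp only [hσ]
    refine ⟨n, σ (σ x) * (n + x + σ x) / n, hn, hn0, div_mul_cancel₀ _ hn0, ?_⟩
    rw [div_pow, hn]
    field_simp
    grind
  have ne_zero : ∀ x : F, x ≠ 0 →
      σ (σ x) ^ 2 + σ (σ x) * σ x * x⁻¹ + σ (σ x) * x * (σ x)⁻¹ ≠ 0 := by
    intro x hx h0
    obtain ⟨n, h, hn, hn0, hh, hf⟩ := root x hx
    have hx₂ : σ (σ x) ≠ 0 := (map_ne_zero σ).2 ((map_ne_zero σ).2 hx)
    rw [h0, sq_eq_zero_iff] at hf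
    rw [hf, zero_mul] at hh
    exact mul_ne_zero hx₂ (twisted_value_ne_zero σ hσ hx₂ hn) hh.symm
  intro x x' hxx
  dsimp only at hxx
  by_cases hx : x = 0
  · by_contra hne
    apply ne_zero x' (fun h => hne (hx.trans h.symm))
    rw [← hxx, hx]
    simp
  by_cases hx' : x' = 0
  · exfalso
    apply ne_zero x hx
    rw [hxx, hx']
    simp
  obtain ⟨n, h, hn, hn0, hh, hf⟩ := root x hx
  obtain ⟨n', h', hn', hn0', hh', hf'⟩ := root x' hx'
  obtain rfl : h = h' := CharTwo.sq_injective (hf.trans (hxx.trans hf'.symm))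
  exact σ.injective (σ.injective (eq_of_twisted_value_eq σ hσ
    ((map_ne_zero σ).2 ((map_ne_zero σ).2 hx)) ((map_ne_zero σ).2 ((map_ne_zero σ).2 hx'))
    hn hn' hh hh'))

theorem stmt_4 (m : ℕ) (hm : 0 < m) (F : Type*) [Field F] [Fintype F]
    (hF : Fintype.card F = (2^m)^3)
    (a : F) (haq : a^(2^m) = a) (ha0 : a ≠ 0) :
    Function.Bijective (fun x : F =>
      x^(2*(2^m)^2) + a * (x^((2^m)^2) * x^(2^m) * x⁻¹)
        + a * (x^((2^m)^2) * x * (x^(2^m))⁻¹)) := by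
  have : CharP F 2 := by
    have : Fact (Nat.Prime 2) := ⟨Nat.prime_two⟩
    exact charP_of_card_eq_prime_pow (f := m * 3) (by rw [hF, pow_mul])
  have hσ (x : F) : iterateFrobenius F 2 m x = x ^ 2 ^ m := iterateFrobenius_def 2 m x
  have hσ₂ (x : F) : x ^ (2 ^ m) ^ 2 = (x ^ 2 ^ m) ^ 2 ^ m := by
    rw [sq (2 ^ m), pow_mul]
  have hσ₃ (x : F) : ((x ^ 2 ^ m) ^ 2 ^ m) ^ 2 ^ m = x := by
    rw [← hσ₂, ← pow_mul, ← pow_succ', ← hF, FiniteField.pow_card]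
  have inj := injective_twisted_trinomial (iterateFrobenius F 2 m) (by simpa only [hσ] using hσ₃)
  simp only [hσ] at inj
  refine Finite.injective_iff_bijective.1 fun x x' hxx => ?_
  have scale (x : F) : x^(2*(2^m)^2) + a * (x^((2^m)^2) * x^(2^m) * x⁻¹)
        + a * (x^((2^m)^2) * x * (x^(2^m))⁻¹) = a ^ 2 * (((((x / a) ^ 2 ^ m) ^ 2 ^ m) ^ 2 +
        ((x / a) ^ 2 ^ m) ^ 2 ^ m * (x / a) ^ 2 ^ m * (x / a)⁻¹) +
        ((x / a) ^ 2 ^ m) ^ 2 ^ m * (x / a) * ((x / a) ^ 2 ^ m)⁻¹) := by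
    rw [mul_comm 2, pow_mul, hσ₂]
    simp only [div_pow, haq]
    field_simp
  rw [scale x, scale x'] at hxx
  exact (div_left_inj' ha0).1 (inj (mul_left_cancel₀ (pow_ne_zero 2 ha0) hxx))
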